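/- (Truncated Φ inequality.) Let Φ : [0,∞) → [0,∞) be non-decreasing and continuous with Φ(βλ) ≤ γ·Φ(λ) for all λ ≥ 0, where β > 1 and γ > 0 are constants. Let Y, Z be nonnegative random variables, a ≥ 0 and ε ∈ (0, 1/γ), and suppose the good λ inequality ℙ(Y > βλ, Z ≤ λ) ≤ ε·ℙ(Y > λ) holds for all λ ≥ a/β. Then 𝔼[Φ(Y)] ≤ Φ(a)/(1−γε) + (γ/(1−γε))·𝔼[Φ(Z)]. -/

import Mathlib

/-! Statement 13: Truncated Φ inequality. -/

open MeasureTheory ENNReal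

noncomputable section

/-- A non-decreasing continuous function on `[0, ∞)` that is at most `t` at `a` and exceeds `t`
at `b` exceeds `t` exactly on `(s, ∞)` for some threshold `s ≥ a`. -/
theorem MonotoneOn.exists_threshold {Φ : ℝ → ℝ} (hmono : MonotoneOn Φ (Set.Ici 0))
    (hcont : ContinuousOn Φ (Set.Ici 0)) {a b t : ℝ} (ha : 0 ≤ a) (hb : 0 ≤ b)
    (hat : Φ a ≤ t) (hbt : t < Φ b) :
    ∃ s, a ≤ s ∧ ∀ x, 0 ≤ x → (t < Φ x ↔ s < x) := by
  have lt_b : ∀ x, 0 ≤ x → Φ x ≤ t → x ≤ b := fun x hx hxt => by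
    by_contra! h
    linarith [hmono hb hx h.le]
  have hK : IsCompact (Set.Icc 0 b ∩ Φ ⁻¹' Set.Iic t) :=
    isCompact_Icc.of_isClosed_subset
      ((hcont.mono Set.Icc_subset_Ici_self).preimage_isClosed_of_isClosed isClosed_Icc
        isClosed_Iic) Set.inter_subset_left
  obtain ⟨s, ⟨⟨hs0, -⟩, hst⟩, hs⟩ := hK.exists_isGreatest ⟨a, ⟨ha, lt_b a ha hat⟩, hat⟩
  refine ⟨s, hs ⟨⟨ha, lt_b a ha hat⟩, hat⟩, fun x hx => ⟨fun h => ?_, fun h => ?_⟩⟩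
  · by_contra! hxs
    exact absurd (hmono hx hs0 hxs) (not_le.2 (lt_of_le_of_lt hst h))
  · by_contra! hxt
    exact absurd (hs ⟨⟨hx, lt_b x hx hxt⟩, hxt⟩) (not_le.2 h)

/-- If the tails of `X` are bounded by those of a constant, of `U` and of `ε` times those of `V`,
then so are the expectations. -/
theorem lintegral_ofReal_le_of_meas_lt_le {Ω : Type*} [MeasurableSpace Ω] {μ : Measure Ω}
    {X U V : Ω → ℝ} (hX : Measurable X) (hU : Measurable U) (hV : Measurable V)
    (hX0 : ∀ ω, 0 ≤ X ω) (hU0 : ∀ ω, 0 ≤ U ω) (hV0 : ∀ ω, 0 ≤ V ω) {A : ℝ} {e : ℝ≥0∞}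
    (h : ∀ t, 0 < t → μ {ω | t < X ω} ≤
      (Set.Iio A).indicator 1 t + (μ {ω | t < U ω} + e * μ {ω | t < V ω})) :
    ∫⁻ ω, ENNReal.ofReal (X ω) ∂μ ≤ ENNReal.ofReal A +
      (∫⁻ ω, ENNReal.ofReal (U ω) ∂μ + e * ∫⁻ ω, ENNReal.ofReal (V ω) ∂μ) := by
  have anti : ∀ W : Ω → ℝ, Measurable fun t : ℝ => μ {ω | t < W ω} := fun W =>
    Antitone.measurable fun s t hst => measure_mono fun ω hω => lt_of_le_of_lt hst hω
  rw [lintegral_eq_lintegral_meas_lt μ (.of_forall hX0) hX.aemeasurable,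
    lintegral_eq_lintegral_meas_lt μ (.of_forall hU0) hU.aemeasurable,
    lintegral_eq_lintegral_meas_lt μ (.of_forall hV0) hV.aemeasurable]
  refine (setLIntegral_mono' measurableSet_Ioi fun t ht => h t ht).trans ?_
  rw [lintegral_add_left (measurable_one.indicator measurableSet_Iio),
    lintegral_add_left (anti U), lintegral_const_mul _ (anti V),
    lintegral_indicator_one measurableSet_Iio, Measure.restrict_apply measurableSet_Iio,
    Set.inter_comm, Set.Ioi_inter_Iio, Real.volume_Ioo, sub_zero]

/-- Absorb a finite term `r * x` with `r < 1` into the left-hand side. -/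
theorem ENNReal.le_of_le_add_ofReal_mul {x A B : ℝ≥0∞} {r : ℝ} (hx : x ≠ ∞) (hr0 : 0 ≤ r)
    (hr1 : r < 1) (h : x ≤ A + (B + ENNReal.ofReal r * x)) :
    x ≤ (A + B) / ENNReal.ofReal (1 - r) := by
  have hc : 0 < 1 - r := by linarith
  rw [ENNReal.le_div_iff_mul_le (.inl (ENNReal.ofReal_pos.2 hc).ne') (.inl ENNReal.ofReal_ne_top)]
  refine ENNReal.le_of_add_le_add_right (ENNReal.mul_ne_top (ENNReal.ofReal_ne_top (r := r)) hx) ?_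
  rw [mul_comm x, ← add_mul, ← ENNReal.ofReal_add hc.le hr0, sub_add_cancel, ENNReal.ofReal_one,
    one_mul, add_assoc]
  exact h

/-- **Truncated Φ inequality.** -/
theorem truncated_phi_inequality
    {Ω : Type*} [MeasurableSpace Ω] (μ : Measure Ω) [IsProbabilityMeasure μ]
    (Φ : ℝ → ℝ) (hmono : MonotoneOn Φ (Set.Ici 0)) (hcont : ContinuousOn Φ (Set.Ici 0))
    (hnonneg : ∀ x, 0 ≤ x → 0 ≤ Φ x)
    (β γ : ℝ) (hβ : 1 < β) (hγ : 0 < γ)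
    (hΦβ : ∀ l : ℝ, 0 ≤ l → Φ (β * l) ≤ γ * Φ l)
    (Y Z : Ω → ℝ) (hYmeas : Measurable Y) (hZmeas : Measurable Z)
    (hYnn : ∀ ω, 0 ≤ Y ω) (hZnn : ∀ ω, 0 ≤ Z ω)
    (a : ℝ) (ha : 0 ≤ a) (ε : ℝ) (hε0 : 0 < ε) (hε1 : ε < 1 / γ)
    (hgood : ∀ l : ℝ, a / β ≤ l →
      μ {ω | β * l < Y ω ∧ Z ω ≤ l} ≤ ENNReal.ofReal ε * μ {ω | l < Y ω}) :
    ∫⁻ ω, ENNReal.ofReal (Φ (Y ω)) ∂μ ≤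
      ENNReal.ofReal (Φ a / (1 - γ * ε)) +
        ENNReal.ofReal (γ / (1 - γ * ε)) * ∫⁻ ω, ENNReal.ofReal (Φ (Z ω)) ∂μ := by
  have hβ0 : 0 < β := by linarith
  have hr0 : 0 ≤ γ * ε := by positivity
  have hr1 : γ * ε < 1 := by
    rw [lt_div_iff₀ hγ] at hε1
    linarith
  have hc : 0 < 1 - γ * ε := by linarith
  have meas : ∀ W : Ω → ℝ, Measurable W → (∀ ω, 0 ≤ W ω) → Measurable fun ω => Φ (W ω) :=
    fun W hW hW0 => by
      have hΦ : Measurable ((Set.Ici (0 : ℝ)).domRestrict Φ) := hcont.domRestrict.measurable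
      exact hΦ.comp (hW.subtype_mk (h := hW0))
  have hmin0 : ∀ (n : ℕ) ω, 0 ≤ min (Y ω) n := fun n ω => le_min (hYnn ω) n.cast_nonneg
  have hminmeas : ∀ n : ℕ, Measurable fun ω => min (Y ω) n := fun n => hYmeas.min measurable_const
  have bound : ∀ n : ℕ, ∫⁻ ω, ENNReal.ofReal (Φ (min (Y ω) n)) ∂μ ≤
      ENNReal.ofReal (Φ a / (1 - γ * ε)) +
        ENNReal.ofReal (γ / (1 - γ * ε)) * ∫⁻ ω, ENNReal.ofReal (Φ (Z ω)) ∂μ := by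
    intro n
    have hXm := meas _ (hminmeas n) (hmin0 n)
    have hZm := meas _ hZmeas hZnn
    have tail : ∀ t, 0 < t → μ {ω | t < Φ (min (Y ω) n)} ≤ (Set.Iio (Φ a)).indicator 1 t +
        (μ {ω | t < γ * Φ (Z ω)} + ENNReal.ofReal ε * μ {ω | t < γ * Φ (min (Y ω) n)}) := by
      intro t _
      rcases lt_or_ge t (Φ a) with hta | hta
      · rw [Set.indicator_of_mem (Set.mem_Iio.2 hta)]
        exact le_add_right prob_le_one
      rw [Set.indicator_of_notMem (Set.notMem_Iio.2 hta), zero_add]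
      rcases le_or_gt (Φ n) t with htn | htn
      · have : {ω | t < Φ (min (Y ω) n)} = ∅ := by
          refine Set.eq_empty_of_forall_notMem fun ω hω => ?_
          have := hmono (hmin0 n ω) (n.cast_nonneg : (0 : ℝ) ≤ n) (min_le_right (Y ω) n)
          exact absurd hω (not_lt.2 (this.trans htn))
        simp [this]
      obtain ⟨s, has, hs⟩ := hmono.exists_threshold hcont ha n.cast_nonneg hta htn
      have hsn : s < n := (hs n n.cast_nonneg).1 htn
      have hβs : β * (s / β) = s := by field_simp
      calc μ {ω | t < Φ (min (Y ω) n)}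
          ≤ μ ({ω | s / β < Z ω} ∪ {ω | β * (s / β) < Y ω ∧ Z ω ≤ s / β}) := by
            refine measure_mono fun ω hω => ?_
            have hY : s < Y ω := ((hs _ (hmin0 n ω)).1 hω).trans_le (min_le_left _ _)
            rcases lt_or_ge (s / β) (Z ω) with h | h
            · exact .inl h
            · exact .inr ⟨hβs.symm ▸ hY, h⟩
        _ ≤ μ {ω | s / β < Z ω} + ENNReal.ofReal ε * μ {ω | s / β < Y ω} :=
            (measure_union_le _ _).trans
              (add_le_add_right (hgood _ (div_le_div_of_nonneg_right has hβ0.le)) _)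
        _ ≤ _ := by
            have scale : ∀ x, 0 ≤ x → s < β * x → t < γ * Φ x := fun x hx h =>
              ((hs _ (by positivity)).2 h).trans_le (hΦβ x hx)
            refine add_le_add (measure_mono fun ω h => ?_)
              (mul_le_mul_right (measure_mono fun ω h => ?_) _)
            · exact scale _ (hZnn ω) ((div_lt_iff₀' hβ0).1 h)
            · refine scale _ (hmin0 n ω) ?_
              rw [mul_min_of_nonneg _ _ hβ0.le]
              refine lt_min ((div_lt_iff₀' hβ0).1 h) (hsn.trans_le ?_)
              exact le_mul_of_one_le_left n.cast_nonneg hβ.le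
    have key := lintegral_ofReal_le_of_meas_lt_le hXm (hZm.const_mul γ) (hXm.const_mul γ)
      (fun ω => hnonneg _ (hmin0 n ω)) (fun ω => mul_nonneg hγ.le (hnonneg _ (hZnn ω)))
      (fun ω => mul_nonneg hγ.le (hnonneg _ (hmin0 n ω))) tail
    simp only [ENNReal.ofReal_mul hγ.le] at key
    rw [lintegral_const_mul _ hZm.ennreal_ofReal, lintegral_const_mul _ hXm.ennreal_ofReal,
      ← mul_assoc (ENNReal.ofReal ε), ← ENNReal.ofReal_mul hε0.le, mul_comm ε γ] at key
    have hfin : ∫⁻ ω, ENNReal.ofReal (Φ (min (Y ω) n)) ∂μ ≠ ∞ := by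
      refine ne_top_of_le_ne_top (ENNReal.ofReal_ne_top (r := Φ n)) ?_
      calc ∫⁻ ω, ENNReal.ofReal (Φ (min (Y ω) n)) ∂μ ≤ ∫⁻ _, ENNReal.ofReal (Φ n) ∂μ :=
            lintegral_mono fun ω => ENNReal.ofReal_le_ofReal
              (hmono (hmin0 n ω) (n.cast_nonneg : (0 : ℝ) ≤ n) (min_le_right _ _))
        _ = ENNReal.ofReal (Φ n) := by simp
    refine (ENNReal.le_of_le_add_ofReal_mul hfin hr0 hr1 key).trans_eq ?_
    rw [ENNReal.add_div, ENNReal.ofReal_div_of_pos hc, ENNReal.ofReal_div_of_pos hc,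
      ENNReal.mul_div_right_comm]
  refine le_of_tendsto' (lintegral_tendsto_of_tendsto_of_monotone
    (fun n => (meas _ (hminmeas n) (hmin0 n)).ennreal_ofReal.aemeasurable)
    (.of_forall fun ω m n hmn => ENNReal.ofReal_le_ofReal
      (hmono (hmin0 m ω) (hmin0 n ω) (min_le_min_left _ (Nat.cast_le.2 hmn))))
    (.of_forall fun ω => ?_)) bound
  refine tendsto_const_nhds.congr' ?_
  filter_upwards [Filter.eventually_ge_atTop ⌈Y ω⌉₊] with n hn
  rw [min_eq_left (Nat.ceil_le.1 hn)]

end
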